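/- A residuated lattice A has the Boolean Lifting Property if and only if for every a ∈ A there exists e ∈ B(A) such that v(a) ⊆ d(e) and v(¬a) ⊆ v(e). -/

import Mathlib

/-- A (commutative integral bounded) residuated lattice: a bounded lattice together
with a commutative monoid structure (whose unit is the top element) and a residuum
operation satisfying the law of residuation. -/
class ResiduatedLattice (A : Type*) extends Lattice A, BoundedOrder A, CommMonoid A where
  rimp : A → A → A
  residuation : ∀ a b c : A, a ≤ rimp b c ↔ a * b ≤ c
  one_eq_top : (1 : A) = ⊤

namespace ResiduatedLattice

variable {A : Type*} [ResiduatedLattice A]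

/-- Negation: ¬a = a → 0. -/
def rneg (a : A) : A := rimp a ⊥

/-- Biresiduum: d(a,b) = (a → b) ∧ (b → a). -/
def bires (a b : A) : A := rimp a b ⊓ rimp b a

/-- Membership in the Boolean center B(A): complemented elements of the bounded lattice. -/
def IsBoolElem (e : A) : Prop := ∃ f : A, e ⊔ f = ⊤ ∧ e ⊓ f = ⊥

/-- A filter of a residuated lattice. -/
def IsRLFilter (F : Set A) : Prop :=
  F.Nonempty ∧ (∀ a b : A, a ∈ F → b ∈ F → a * b ∈ F) ∧ (∀ a b : A, a ∈ F → a ≤ b → b ∈ F)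

/-- The principal filter [x) = {a | xⁿ ≤ a for some n ≥ 1}. -/
def princ (x : A) : Set A := {a : A | ∃ n : ℕ, 1 ≤ n ∧ x ^ n ≤ a}

/-- A filter F has the Boolean Lifting Property. -/
def HasBLP (F : Set A) : Prop :=
  ∀ a : A, a ⊔ rneg a ∈ F → ∃ e : A, IsBoolElem e ∧ bires a e ∈ F

/-- A filter F has the Idempotent Lifting Property. -/
def HasILP (F : Set A) : Prop :=
  ∀ a : A, bires a (a * a) ∈ F → ∃ e : A, e * e = e ∧ bires a e ∈ F

/-- A proper filter. -/
def IsProperRLFilter (F : Set A) : Prop := IsRLFilter F ∧ F ≠ Set.univ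

/-- A maximal filter: a proper filter maximal under inclusion among proper filters. -/
def IsMaxRLFilter (M : Set A) : Prop :=
  IsProperRLFilter M ∧ ∀ G : Set A, IsProperRLFilter G → M ⊆ G → G = M

/-- A prime filter: a proper filter P with a ∨ b ∈ P → a ∈ P or b ∈ P. -/
def IsPrimeRLFilter (P : Set A) : Prop :=
  IsProperRLFilter P ∧ ∀ a b : A, a ⊔ b ∈ P → a ∈ P ∨ b ∈ P

/-- The radical: intersection of all maximal filters. -/
def rad (A : Type*) [ResiduatedLattice A] : Set A :=
  {a : A | ∀ M : Set A, IsMaxRLFilter M → a ∈ M}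

/-- v(a) = set of maximal filters containing a. -/
def vset (a : A) : Set (Set A) := {M : Set A | IsMaxRLFilter M ∧ a ∈ M}

/-- d(a) = set of maximal filters not containing a. -/
def dset (a : A) : Set (Set A) := {M : Set A | IsMaxRLFilter M ∧ a ∉ M}

/-- An element is nilpotent iff some positive power of it is 0. -/
def RLNilpotent (a : A) : Prop := ∃ n : ℕ, 1 ≤ n ∧ a ^ n = ⊥

/-- The join F ∨ G of two filters: the smallest filter including F ∪ G. -/
def filtJoin (F G : Set A) : Set A := ⋂₀ {H : Set A | IsRLFilter H ∧ F ∪ G ⊆ H}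

end ResiduatedLattice

namespace ResiduatedLattice

variable {A : Type*} [ResiduatedLattice A]

theorem aux_mul_le_mul_right {a b : A} (h : a ≤ b) (c : A) : a * c ≤ b * c := by
  rw [← residuation]
  exact h.trans ((residuation b c (b * c)).2 le_rfl)

theorem aux_mul_le_mul_left {a b : A} (h : a ≤ b) (c : A) : c * a ≤ c * b := by
  rw [mul_comm c a, mul_comm c b]
  exact aux_mul_le_mul_right h c

theorem aux_mul_le_left (a b : A) : a * b ≤ a := by
  have h : b ≤ 1 := by rw [one_eq_top]; exact le_top
  have := aux_mul_le_mul_left h a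
  rwa [mul_one] at this

theorem aux_mul_le_right (a b : A) : a * b ≤ b := by
  rw [mul_comm]; exact aux_mul_le_left b a

theorem aux_sup_mul_le {a b c d : A} (h1 : a * c ≤ d) (h2 : b * c ≤ d) : (a ⊔ b) * c ≤ d := by
  rw [← residuation] at *
  exact sup_le h1 h2

theorem aux_rneg_mul (a : A) : rneg a * a ≤ ⊥ := (residuation _ _ _).1 le_rfl

theorem aux_imp_mul (a b : A) : rimp a b * a ≤ b := (residuation _ _ _).1 le_rfl

theorem aux_compl_mul {e f : A} (h : e ⊓ f = ⊥) : e * f ≤ ⊥ := by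
  rw [← h]
  exact le_inf (aux_mul_le_left _ _) (aux_mul_le_right _ _)

theorem aux_le_compl {e f x : A} (h : e ⊔ f = ⊤) (hx : x * e ≤ ⊥) : x ≤ f := by
  have h1 : (e ⊔ f) * x ≤ f :=
    aux_sup_mul_le (by rw [mul_comm]; exact hx.trans bot_le) (aux_mul_le_left _ _)
  rwa [h, ← one_eq_top, one_mul] at h1

theorem aux_idem {e f : A} (h : e ⊔ f = ⊤) (h' : e ⊓ f = ⊥) : e ≤ e * e := by
  have h1 : (e ⊔ f) * e ≤ e * e :=
    aux_sup_mul_le le_rfl (by rw [mul_comm]; exact (aux_compl_mul h').trans bot_le)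
  rwa [h, ← one_eq_top, one_mul] at h1

theorem aux_idem_pow {e : A} (h : e ≤ e * e) (n : ℕ) : e ≤ e ^ n := by
  induction n with
  | zero => rw [pow_zero, one_eq_top]; exact le_top
  | succ k ih => rw [pow_succ]; exact h.trans (aux_mul_le_mul_right ih e)

theorem aux_pow_mem {F : Set A} (hF : IsRLFilter F) {x : A} (hx : x ∈ F) (n : ℕ) :
    x ^ n ∈ F := by
  induction n with
  | zero =>
    rw [pow_zero, one_eq_top]; exact hF.2.2 _ _ hx le_top
  | succ k ih => rw [pow_succ]; exact hF.2.1 _ _ ih hx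

theorem aux_princ (x : A) : IsRLFilter (princ x) := by
  refine ⟨⟨x, 1, le_rfl, by simp⟩, ?_, ?_⟩
  · rintro a b ⟨n, hn, h1⟩ ⟨m, hm, h2⟩
    refine ⟨n + m, by omega, ?_⟩
    rw [pow_add]
    exact (aux_mul_le_mul_right h1 _).trans (aux_mul_le_mul_left h2 _)
  · rintro a b ⟨n, hn, h1⟩ h
    exact ⟨n, hn, h1.trans h⟩

theorem aux_proper_iff {F : Set A} (hF : IsRLFilter F) : F ≠ Set.univ ↔ ⊥ ∉ F := by
  constructor
  · intro h hb
    exact h (Set.eq_univ_of_forall fun x => hF.2.2 _ _ hb bot_le)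
  · rintro h rfl
    exact h trivial

theorem aux_exists_max {x : A} (hx : ∀ n : ℕ, x ^ n ≠ ⊥) :
    ∃ M : Set A, IsMaxRLFilter M ∧ x ∈ M := by
  have hp : IsProperRLFilter (princ x) := by
    refine ⟨aux_princ x, (aux_proper_iff (aux_princ x)).2 ?_⟩
    rintro ⟨n, _, h⟩
    exact hx n (le_bot_iff.1 h)
  obtain ⟨M, hsub, hM⟩ := zorn_subset_nonempty {F : Set A | IsProperRLFilter F} (by
    intro c hc hch hne
    refine ⟨⋃₀ c, ?_, fun s hs => Set.subset_sUnion_of_mem hs⟩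
    have hfil : IsRLFilter (⋃₀ c) := by
      refine ⟨?_, ?_, ?_⟩
      · obtain ⟨s, hs⟩ := hne
        obtain ⟨y, hy⟩ := (hc hs).1.1
        exact ⟨y, s, hs, hy⟩
      · rintro a b ⟨s, hs, ha⟩ ⟨t, ht, hb⟩
        rcases hch.total hs ht with h | h
        · exact ⟨t, ht, (hc ht).1.2.1 _ _ (h ha) hb⟩
        · exact ⟨s, hs, (hc hs).1.2.1 _ _ ha (h hb)⟩
      · rintro a b ⟨s, hs, ha⟩ hab
        exact ⟨s, hs, (hc hs).1.2.2 _ _ ha hab⟩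
    refine ⟨hfil, (aux_proper_iff hfil).2 ?_⟩
    rintro ⟨s, hs, hb⟩
    exact (aux_proper_iff (hc hs).1).1 (hc hs).2 hb) (princ x) hp
  refine ⟨M, ⟨hM.prop, fun G hG hMG => ?_⟩, hsub ⟨1, le_rfl, by simp⟩⟩
  exact (hM.eq_of_subset hG hMG).symm

theorem aux_pow_absorb (a b : A) (hab : b * a ≤ ⊥) (n : ℕ) : (a ⊔ b) ^ n * a ≤ a ^ n := by
  induction n with
  | zero => rw [pow_zero, pow_zero, one_mul, one_eq_top]; exact le_top
  | succ k ih =>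
    have h1 : (a ⊔ b) * a ≤ a * a := aux_sup_mul_le le_rfl (hab.trans bot_le)
    calc (a ⊔ b) ^ (k + 1) * a = (a ⊔ b) ^ k * ((a ⊔ b) * a) := by rw [pow_succ, mul_assoc]
      _ ≤ (a ⊔ b) ^ k * (a * a) := aux_mul_le_mul_left h1 _
      _ = ((a ⊔ b) ^ k * a) * a := by rw [mul_assoc]
      _ ≤ a ^ k * a := aux_mul_le_mul_right ih _
      _ = a ^ (k + 1) := by rw [pow_succ]

theorem aux_forward (H : ∀ F : Set A, IsRLFilter F → HasBLP F) (a : A) :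
    ∃ e : A, IsBoolElem e ∧ vset a ⊆ dset e ∧ vset (rneg a) ⊆ vset e := by
  obtain ⟨e, ⟨f, h1, h2⟩, n, hn, hd⟩ :=
    H (princ (a ⊔ rneg a)) (aux_princ _) a ⟨1, le_rfl, by simp⟩
  refine ⟨f, ⟨e, by rw [sup_comm, h1], by rw [inf_comm, h2]⟩, ?_, ?_⟩
  · rintro M ⟨hM, ha⟩
    have hF := hM.1.1
    refine ⟨hM, fun hf => (aux_proper_iff hF).1 hM.1.2 ?_⟩
    have hu : bires a e ∈ M := hF.2.2 _ _ (aux_pow_mem hF (hF.2.2 _ _ ha le_sup_left) n) hd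
    have hi : rimp a e ∈ M := hF.2.2 _ _ hu inf_le_left
    have he : e ∈ M := hF.2.2 _ _ (hF.2.1 _ _ hi ha) (aux_imp_mul a e)
    exact hF.2.2 _ _ (hF.2.1 _ _ he hf) (aux_compl_mul h2)
  · rintro M ⟨hM, ha⟩
    have hF := hM.1.1
    refine ⟨hM, ?_⟩
    have hu : bires a e ∈ M := hF.2.2 _ _ (aux_pow_mem hF (hF.2.2 _ _ ha le_sup_right) n) hd
    have hi : rimp e a ∈ M := hF.2.2 _ _ hu inf_le_right
    refine hF.2.2 _ _ (hF.2.1 _ _ ha hi) (aux_le_compl h1 ?_)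
    rw [mul_assoc]
    exact (aux_mul_le_mul_left (aux_imp_mul e a) _).trans (aux_rneg_mul a)

theorem aux_backward
    (H : ∀ a : A, ∃ e : A, IsBoolElem e ∧ vset a ⊆ dset e ∧ vset (rneg a) ⊆ vset e)
    (F : Set A) (hF : IsRLFilter F) : HasBLP F := by
  intro a hu
  obtain ⟨e, ⟨f, h1, h2⟩, hv, hw⟩ := H a
  have h1' : f ⊔ e = ⊤ := by rw [sup_comm, h1]
  have h2' : f ⊓ e = ⊥ := by rw [inf_comm, h2]
  have key1 : ∃ n : ℕ, (a * e) ^ n = ⊥ := by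
    by_contra hc
    push Not at hc
    obtain ⟨M, hM, hx⟩ := aux_exists_max hc
    exact (hv ⟨hM, hM.1.1.2.2 _ _ hx (aux_mul_le_left _ _)⟩).2
      (hM.1.1.2.2 _ _ hx (aux_mul_le_right _ _))
  have key2 : ∃ n : ℕ, (rneg a * f) ^ n = ⊥ := by
    by_contra hc
    push Not at hc
    obtain ⟨M, hM, hx⟩ := aux_exists_max hc
    have he := (hw ⟨hM, hM.1.1.2.2 _ _ hx (aux_mul_le_left _ _)⟩).2
    have hf := hM.1.1.2.2 _ _ hx (aux_mul_le_right _ _)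
    exact (aux_proper_iff hM.1.1).1 hM.1.2
      (hM.1.1.2.2 _ _ (hM.1.1.2.1 _ _ he hf) (aux_compl_mul h2))
  obtain ⟨n, hn⟩ := key1
  obtain ⟨m, hm⟩ := key2
  have hn' : a ^ n ≤ f := by
    refine aux_le_compl h1 ?_
    rw [← hn, mul_pow]
    exact aux_mul_le_mul_left (aux_idem_pow (aux_idem h1 h2) n) _
  have hm' : rneg a ^ m * f ≤ ⊥ := by
    rw [← hm, mul_pow]
    exact aux_mul_le_mul_left (aux_idem_pow (aux_idem h1' h2') m) _
  refine ⟨f, ⟨e, h1', h2'⟩, ?_⟩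
  have hA : (a ⊔ rneg a) ^ n ≤ rimp a f := by
    rw [residuation]
    exact (aux_pow_absorb a (rneg a) (aux_rneg_mul a) n).trans hn'
  have hB : (a ⊔ rneg a) ^ (m + 1) ≤ rimp f a := by
    rw [residuation, pow_succ, mul_comm _ (a ⊔ rneg a), mul_assoc]
    refine aux_sup_mul_le (aux_mul_le_left _ _) ?_
    rw [← mul_assoc, mul_comm (rneg a), sup_comm]
    refine (aux_mul_le_mul_right
      (aux_pow_absorb (rneg a) a (by rw [mul_comm]; exact aux_rneg_mul a) m) f).trans ?_
    exact hm'.trans bot_le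
  refine hF.2.2 _ _ (hF.2.1 _ _ (aux_pow_mem hF hu n) (aux_pow_mem hF hu (m + 1))) ?_
  exact le_inf ((aux_mul_le_left _ _).trans hA) ((aux_mul_le_right _ _).trans hB)

end ResiduatedLattice

open ResiduatedLattice in
theorem stmt_12 {A : Type*} [ResiduatedLattice A] :
    (∀ F : Set A, IsRLFilter F → HasBLP F) ↔
      (∀ a : A, ∃ e : A, IsBoolElem e ∧ vset a ⊆ dset e ∧ vset (rneg a) ⊆ vset e) :=
  ⟨aux_forward, aux_backward⟩
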